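/- arXiv:0801.4043 — 2 statements merged into one kernel-verified Lean document; each statement's English description precedes it below -/
import Mathlib

section
/- Let P(w) be a C^∞ family of N×N complex matrices near w_0 in R^d, and suppose λ(w) is a continuous section of eigenvalues of P(w) with constant algebraic multiplicity k near w_0. Then λ(w) is a C^∞ function of w near w_0. -/
open Polynomial in
/-- Smoothness of all coefficients of a product. -/
lemma coeff_prod_contDiff {E ι : Type*} [NormedAddCommGroup E] [NormedSpace ℝ E]
    (s : Finset ι) (Q : ι → E → ℂ[X])
    (h : ∀ i ∈ s, ∀ n, ContDiff ℝ (⊤ : ℕ∞) fun w => (Q i w).coeff n) :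
    ∀ n, ContDiff ℝ (⊤ : ℕ∞) fun w => (∏ i ∈ s, Q i w).coeff n := by
  classical
  induction s using Finset.induction_on with
  | empty => intro n; simpa using contDiff_const
  | insert a s ha ih =>
    intro n
    simp only [Finset.prod_insert ha, Polynomial.coeff_mul]
    refine ContDiff.sum fun x _ => ?_
    exact (h a (by simp) _).mul (ih (fun i hi => h i (by simp [hi])) _)

lemma charpoly_coeff_contDiff {d N : ℕ} (P : (Fin d → ℝ) → Matrix (Fin N) (Fin N) ℂ)
    (hP : ∀ i j, ContDiff ℝ (⊤ : ℕ∞) fun w => P w i j) (n : ℕ) :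
    ContDiff ℝ (⊤ : ℕ∞) fun w => (P w).charpoly.coeff n := by
  simp only [Matrix.charpoly, Matrix.det_apply', Polynomial.finsetSum_coeff]
  refine ContDiff.sum fun σ _ => ?_
  have h := coeff_prod_contDiff Finset.univ (fun i w => (P w).charmatrix (σ i) i) ?_ n
  · have e : ∀ w, ((((Equiv.Perm.sign σ : ℤ) : Polynomial ℂ)) *
        ∏ i, (P w).charmatrix (σ i) i).coeff n
        = ((Equiv.Perm.sign σ : ℤ) : ℂ) * (∏ i, (P w).charmatrix (σ i) i).coeff n := by
      intro w
      rw [← Polynomial.coeff_C_mul]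
      simp
    simp only [e]
    exact contDiff_const.mul h
  · intro i _ m
    simp only [Matrix.charmatrix_apply, Polynomial.coeff_sub, Polynomial.coeff_C]
    refine contDiff_const.sub ?_
    split_ifs
    · exact hP _ _
    · exact contDiff_const

lemma eval_iterate_derivative_contDiff {d N : ℕ} (P : (Fin d → ℝ) → Matrix (Fin N) (Fin N) ℂ)
    (hP : ∀ i j, ContDiff ℝ (⊤ : ℕ∞) fun w => P w i j) (m : ℕ) :
    ContDiff ℝ (⊤ : ℕ∞) fun u : (Fin d → ℝ) × ℂ =>
      (Polynomial.derivative^[m] (P u.1).charpoly).eval u.2 := by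
  have e : ∀ u : (Fin d → ℝ) × ℂ, (Polynomial.derivative^[m] (P u.1).charpoly).eval u.2
      = ∑ i ∈ Finset.range (N + 1),
        (Polynomial.derivative^[m] (P u.1).charpoly).coeff i * u.2 ^ i := by
    intro u
    refine Polynomial.eval_eq_sum_range' ?_ _
    have h1 := Polynomial.natDegree_iterate_derivative (P u.1).charpoly m
    have h2 := Matrix.charpoly_natDegree_eq_dim (P u.1)
    rw [Fintype.card_fin] at h2
    omega
  simp only [e, Polynomial.coeff_iterate_derivative, nsmul_eq_mul]
  refine ContDiff.sum fun i _ => ContDiff.mul (contDiff_const.mul ?_) (contDiff_snd.pow i)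
  exact (charpoly_coeff_contDiff P hP _).comp contDiff_fst

/-- A continuous section of eigenvalues of a smooth matrix family with constant
algebraic multiplicity is smooth. -/
theorem smooth_eigenvalue_of_constant_algebraic_multiplicity
    {d N : ℕ} (P : (Fin d → ℝ) → Matrix (Fin N) (Fin N) ℂ)
    (lam : (Fin d → ℝ) → ℂ) (w₀ : Fin d → ℝ) (U : Set (Fin d → ℝ)) (k : ℕ)
    (hU : IsOpen U) (hw₀ : w₀ ∈ U)
    (hP : ∀ i j, ContDiff ℝ (⊤ : ℕ∞) fun w => P w i j)
    (hlam : ContinuousOn lam U)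
    (hk : 1 ≤ k)
    (hroot : ∀ w ∈ U, Polynomial.rootMultiplicity (lam w) (P w).charpoly = k) :
    ∃ V ∈ nhds w₀, ContDiffOn ℝ (⊤ : ℕ∞) lam V := by
  refine ⟨U, hU.mem_nhds hw₀, fun w hw => ContDiffAt.contDiffWithinAt ?_⟩
  obtain ⟨m, rfl⟩ : ∃ m, k = m + 1 := ⟨k - 1, by omega⟩
  set f : (Fin d → ℝ) × ℂ → ℂ := fun u =>
      (Polynomial.derivative^[m] (P u.1).charpoly).eval u.2 with hf
  have hfs : ContDiff ℝ (⊤ : ℕ∞) f := eval_iterate_derivative_contDiff P hP m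
  have hzero : ∀ v ∈ U, f (v, lam v) = 0 := by
    intro v hv
    exact Polynomial.isRoot_iterate_derivative_of_lt_rootMultiplicity
      (by rw [hroot v hv]; omega)
  set c : ℂ := (Polynomial.derivative^[m + 1] (P w).charpoly).eval (lam w) with hc
  have hc0 : c ≠ 0 := by
    intro h0
    have hne : (P w).charpoly ≠ 0 := (Matrix.charpoly_monic _).ne_zero
    have := (Polynomial.lt_rootMultiplicity_iff_isRoot_iterate_derivative
      (n := m + 1) (t := lam w) hne).2 (by
        intro j hj
        rcases Nat.lt_or_ge j (m + 1) with h | h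
        · exact Polynomial.isRoot_iterate_derivative_of_lt_rootMultiplicity
            (by rw [hroot w hw]; omega)
        · obtain rfl : j = m + 1 := by omega
          exact h0)
    rw [hroot w hw] at this
    omega
  have hd : HasDerivAt (fun z => f (w, z)) c (lam w) := by
    have := (Polynomial.derivative^[m] (P w).charpoly).hasDerivAt (lam w)
    rwa [← Function.iterate_succ_apply' (f := Polynomial.derivative)] at this
  have hn : ((⊤ : ℕ∞) : WithTop ℕ∞) ≠ 0 := by simp
  have hinv : (fderiv ℝ f (w, lam w) ∘L .inr ℝ (Fin d → ℝ) ℂ).IsInvertible := by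
    have h1 : HasFDerivAt (fun z => f (w, z))
        (fderiv ℝ f (w, lam w) ∘L .inr ℝ (Fin d → ℝ) ℂ) (lam w) :=
      (hfs.differentiable hn (w, lam w)).hasFDerivAt.comp (lam w)
        (hasFDerivAt_prodMk_right w (lam w))
    have h2 := hd.hasFDerivAt.restrictScalars ℝ
    rw [h1.unique h2]
    refine ⟨(ContinuousLinearEquiv.unitsEquivAut ℂ (Units.mk0 c hc0)).restrictScalars ℝ, ?_⟩
    ext; simp
  have hfa : ContDiffAt ℝ (⊤ : ℕ∞) f (w, lam w) := hfs.contDiffAt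
  have hs := hfa.contDiffAt_implicitFunction hn hinv
  refine hs.congr_of_eventuallyEq ?_
  have hev := hfa.eventually_apply_eq_iff_implicitFunction hn hinv
  have hcont : Filter.Tendsto (fun v => (v, lam v)) (nhds w) (nhds (w, lam w)) :=
    (continuousAt_id.prodMk (hlam.continuousAt (hU.mem_nhds hw)))
  filter_upwards [hcont.eventually hev, hU.mem_nhds hw] with v hv hvU
  exact (hv.1 (by rw [hzero v hvU, hzero w hw])).symm
end

section
/- Let P(w) be a C^∞ family of N×N matrices with det P(w_0) = 0, and let k = dim ker P(w_0). Then P is of principal type at w_0 if and only if there exists a direction ν such that ∂_ν^k det P(w_0) ≠ 0. Moreover ∂_ν^j det P(w_0) = 0 for all j < k and all directions ν. -/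
/-- The directional derivative `∂_ν P(w₀)` of a matrix family, taken entrywise. -/
noncomputable def dirDeriv {d N : ℕ}
    (P : (Fin d → ℝ) → Matrix (Fin N) (Fin N) ℂ) (w₀ ν : Fin d → ℝ) :
    Matrix (Fin N) (Fin N) ℂ :=
  Matrix.of fun i j => deriv (fun s : ℝ => P (w₀ + s • ν) i j) 0

/-- `P` is of principal type at `w₀`: for some direction `ν`, the map
`u ↦ ∂_ν P(w₀) u` from `ker P(w₀)` to `ℂ^N / Ran P(w₀)` is bijective. -/
def IsPrincipalTypeAt {d N : ℕ}
    (P : (Fin d → ℝ) → Matrix (Fin N) (Fin N) ℂ) (w₀ : Fin d → ℝ) : Prop :=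
  ∃ ν : Fin d → ℝ, Function.Bijective
    (fun u : LinearMap.ker (P w₀).mulVecLin =>
      (Submodule.Quotient.mk ((dirDeriv P w₀ ν).mulVec u.1) :
        (Fin N → ℂ) ⧸ LinearMap.range (P w₀).mulVecLin))

open Filter Topology in
/-- Taylor's theorem when the lower derivatives vanish. -/
lemma tendsto_of_lower_zero (f : ℝ → ℂ) (hf : ContDiff ℝ (⊤ : ℕ∞) f) (j : ℕ)
    (h : ∀ i < j, iteratedDeriv i f 0 = 0) :
    Tendsto (fun s : ℝ => (s ^ j)⁻¹ • f s) (𝓝[≠] 0)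
      (𝓝 ((j.factorial : ℝ)⁻¹ • iteratedDeriv j f 0)) := by
  have hfj : ContDiff ℝ j f := hf.of_le (by exact_mod_cast le_top)
  have h1 := taylor_tendsto (f := f) (x₀ := 0) (n := j) convex_univ (Set.mem_univ _)
    hfj.contDiffOn
  rw [nhdsWithin_univ] at h1
  have h2 := (h1.mono_left (nhdsWithin_le_nhds (s := {0}ᶜ))).add_const
    ((j.factorial : ℝ)⁻¹ • iteratedDeriv j f 0)
  rw [zero_add] at h2
  refine h2.congr' ?_
  filter_upwards [self_mem_nhdsWithin] with s hs
  have hs : s ≠ 0 := hs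
  have ht : taylorWithinEval f j Set.univ 0 s
      = ((j.factorial : ℝ)⁻¹ * s ^ j) • iteratedDeriv j f 0 := by
    rw [taylor_within_apply, Finset.sum_range_succ, Finset.sum_eq_zero]
    · simp [iteratedDerivWithin_univ]
    · intro i hi
      rw [iteratedDerivWithin_univ, h i (Finset.mem_range.mp hi), smul_zero]
  rw [ht, sub_zero, smul_sub, smul_smul]
  have : (s ^ j)⁻¹ * ((j.factorial : ℝ)⁻¹ * s ^ j) = (j.factorial : ℝ)⁻¹ := by
    have := pow_ne_zero j hs
    field_simp
  rw [this, sub_add_cancel]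

open Filter Topology in
lemma derivs_of_factor (f g : ℝ → ℂ) (hf : ContDiff ℝ (⊤ : ℕ∞) f) (k : ℕ)
    (hg : ContinuousAt g 0) (hfg : ∀ s, f s = (s : ℂ) ^ k * g s) :
    (∀ j < k, iteratedDeriv j f 0 = 0) ∧ (iteratedDeriv k f 0 = k.factorial * g 0) := by
  have hg' : Tendsto g (𝓝[≠] 0) (𝓝 (g 0)) := hg.tendsto.mono_left nhdsWithin_le_nhds
  have low : ∀ j < k, iteratedDeriv j f 0 = 0 := by
    intro j
    induction j using Nat.strong_induction_on with
    | _ j ih =>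
      intro hj
      have h1 := tendsto_of_lower_zero f hf j (fun i hi => ih i hi (hi.trans hj))
      have h2 : Tendsto (fun s : ℝ => (s ^ j)⁻¹ • f s) (𝓝[≠] 0) (𝓝 0) := by
        have h3 : Tendsto (fun s : ℝ => (s : ℂ) ^ (k - j) * g s) (𝓝[≠] 0) (𝓝 0) := by
          have h4 : Tendsto (fun s : ℝ => (s : ℂ) ^ (k - j)) (𝓝[≠] 0) (𝓝 0) := by
            have : Continuous (fun s : ℝ => (s : ℂ) ^ (k - j)) := by fun_prop
            have h5 := this.tendsto 0
            simp only [Complex.ofReal_zero, zero_pow (Nat.sub_ne_zero_of_lt hj)] at h5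
            exact h5.mono_left nhdsWithin_le_nhds
          simpa using h4.mul hg'
        refine h3.congr' ?_
        filter_upwards [self_mem_nhdsWithin] with s hs
        have hs : (s : ℂ) ≠ 0 := by exact_mod_cast hs
        have e : k = j + (k - j) := by omega
        rw [hfg, Complex.real_smul]
        have e2 : (s : ℂ) ^ k = (s : ℂ) ^ j * (s : ℂ) ^ (k - j) := by rw [← pow_add, ← e]
        rw [e2]
        have := pow_ne_zero j hs
        push_cast
        field_simp
      have := tendsto_nhds_unique h1 h2
      have hfac : ((j.factorial : ℝ)⁻¹) ≠ 0 := by positivity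
      exact (smul_eq_zero.mp this).resolve_left hfac
  refine ⟨low, ?_⟩
  have h1 := tendsto_of_lower_zero f hf k low
  have h2 : Tendsto (fun s : ℝ => (s ^ k)⁻¹ • f s) (𝓝[≠] 0) (𝓝 (g 0)) := by
    refine hg'.congr' ?_
    filter_upwards [self_mem_nhdsWithin] with s hs
    have hs : (s : ℂ) ≠ 0 := by exact_mod_cast hs
    rw [hfg, Complex.real_smul]
    have := pow_ne_zero k hs
    push_cast
    field_simp
  have := tendsto_nhds_unique h1 h2
  rw [← this, Complex.real_smul]
  have : (k.factorial : ℂ) ≠ 0 := by exact_mod_cast k.factorial_ne_zero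
  push_cast
  field_simp

lemma exists_adapted_basis {N : ℕ} (K : Submodule ℂ (Fin N → ℂ)) :
    ∃ (p : (Fin N → ℂ) →ₗ[ℂ] (Fin N → ℂ)) (b : Module.Basis (Fin N) ℂ (Fin N → ℂ))
      (S : Finset (Fin N)), S.card = Module.finrank ℂ K ∧ (∀ x, p x ∈ K) ∧
      (∀ x ∈ K, p x = x) ∧ ∀ i, p (b i) = if i ∈ S then b i else 0 := by
  classical
  obtain ⟨C, hC⟩ := K.exists_isCompl
  let b0 := ((Module.finBasis ℂ K).prod (Module.finBasis ℂ C)).map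
    (Submodule.prodEquivOfIsCompl K C hC)
  let e := b0.indexEquiv (Pi.basisFun ℂ (Fin N))
  refine ⟨K.projection C hC, b0.reindex e,
    Finset.univ.map (Function.Embedding.inl.trans e.toEmbedding), by simp,
    Submodule.projection_apply_mem hC,
    fun x hx => Submodule.projection_apply_of_mem_left hC hx, ?_⟩
  intro i
  obtain ⟨i, rfl⟩ := e.surjective i
  rcases i with i | i
  · simp [b0]
  · simp [b0]

lemma bijective_iff {N : ℕ} (T D : Matrix (Fin N) (Fin N) ℂ)
    (p : (Fin N → ℂ) →ₗ[ℂ] (Fin N → ℂ))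
    (hp : ∀ x, p x ∈ LinearMap.ker T.mulVecLin)
    (hp' : ∀ x ∈ LinearMap.ker T.mulVecLin, p x = x) :
    Function.Bijective (fun u : LinearMap.ker T.mulVecLin =>
      (Submodule.Quotient.mk (D.mulVec u.1) :
        (Fin N → ℂ) ⧸ LinearMap.range T.mulVecLin)) ↔
    Function.Injective
      (D.mulVecLin ∘ₗ p + T.mulVecLin ∘ₗ (LinearMap.id - p) : (Fin N → ℂ) →ₗ[ℂ] (Fin N → ℂ)) := by
  let φ : LinearMap.ker T.mulVecLin →ₗ[ℂ] (Fin N → ℂ) ⧸ LinearMap.range T.mulVecLin :=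
    (LinearMap.range T.mulVecLin).mkQ ∘ₗ D.mulVecLin ∘ₗ (LinearMap.ker T.mulVecLin).subtype
  have hfin : Module.finrank ℂ (LinearMap.ker T.mulVecLin) =
      Module.finrank ℂ ((Fin N → ℂ) ⧸ LinearMap.range T.mulVecLin) := by
    have h1 := LinearMap.finrank_range_add_finrank_ker T.mulVecLin
    have h2 := Submodule.finrank_quotient_add_finrank (LinearMap.range T.mulVecLin)
    omega
  have hb : Function.Bijective φ ↔ Function.Injective φ :=
    ⟨fun h => h.1, fun h =>
      ⟨h, (LinearMap.injective_iff_surjective_of_finrank_eq_finrank hfin).mp h⟩⟩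
  change Function.Bijective φ ↔ _
  rw [hb]
  constructor
  · intro h
    rw [injective_iff_map_eq_zero] at h ⊢
    intro x hx
    have hTp : T.mulVec (p x) = 0 := by simpa using hp x
    have hx' : D.mulVec (p x) + T.mulVec x = 0 := by
      simpa [Matrix.mulVec_sub, hTp] using hx
    have h0 := h ⟨p x, hp x⟩ (by
      change Submodule.Quotient.mk (D.mulVec (p x)) = _
      rw [Submodule.Quotient.mk_eq_zero]
      refine ⟨-x, ?_⟩
      rw [Matrix.mulVecLin_apply, Matrix.mulVec_neg]
      exact (eq_neg_of_add_eq_zero_left hx').symm)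
    have hpx : p x = 0 := by simpa using congrArg Subtype.val h0
    rw [hpx, Matrix.mulVec_zero, zero_add] at hx'
    rw [← hp' x (by simpa using hx'), hpx]
  · intro h
    rw [injective_iff_map_eq_zero] at h ⊢
    rintro ⟨u, hu⟩ hφ
    have hφ : (Submodule.Quotient.mk (D.mulVec u) :
      (Fin N → ℂ) ⧸ LinearMap.range T.mulVecLin) = 0 := hφ
    rw [Submodule.Quotient.mk_eq_zero] at hφ
    obtain ⟨w, hw⟩ := hφ
    have hw : T.mulVec w = D.mulVec u := hw
    have hTp : T.mulVec (p w) = 0 := by simpa using hp w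
    have hpp : p (p w) = p w := hp' _ (hp w)
    have hpu : p u = u := hp' _ hu
    have := h (u - (w - p w)) (by
      simp [Matrix.mulVec_sub, hTp, hpp, hpu, hw])
    have h2 := congrArg p this
    simp [hpp, hpu] at h2
    simp [h2]

lemma key {N : ℕ} (Q : ℝ → Matrix (Fin N) (Fin N) ℂ)
    (hQ : ∀ i j, ContDiff ℝ (⊤ : ℕ∞) fun s => Q s i j) (k : ℕ)
    (hk : k = Module.finrank ℂ (LinearMap.ker (Q 0).mulVecLin)) :
    (Function.Bijective (fun u : LinearMap.ker (Q 0).mulVecLin =>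
      (Submodule.Quotient.mk
        ((Matrix.of fun i j => deriv (fun s : ℝ => Q s i j) 0).mulVec u.1) :
        (Fin N → ℂ) ⧸ LinearMap.range (Q 0).mulVecLin)) ↔
      iteratedDeriv k (fun s => (Q s).det) 0 ≠ 0) ∧
    ∀ j < k, iteratedDeriv j (fun s => (Q s).det) 0 = 0 := by
  classical
  obtain ⟨p, b, S, hS, hp, hp', hpb⟩ := exists_adapted_basis (LinearMap.ker (Q 0).mulVecLin)
  set D : Matrix (Fin N) (Fin N) ℂ := Matrix.of fun i j => deriv (fun s : ℝ => Q s i j) 0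
    with hD
  rw [bijective_iff (Q 0) D p hp hp']
  set F := D.mulVecLin ∘ₗ p + (Q 0).mulVecLin ∘ₗ (LinearMap.id - p) with hF
  let B : Matrix (Fin N) (Fin N) ℂ := Matrix.of fun i j => b j i
  have hB : B.det ≠ 0 := by
    have : IsUnit B := by
      rw [← Matrix.linearIndependent_cols_iff_isUnit]
      exact b.linearIndependent
    exact ((Matrix.isUnit_iff_isUnit_det B).mp this).ne_zero
  have hcol : ∀ (A : Matrix (Fin N) (Fin N) ℂ) i j, (A * B) i j = A.mulVec (b j) i :=
    fun A i j => rfl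
  have hsm : ∀ i j, ContDiff ℝ (⊤ : ℕ∞) (fun s => (Q s).mulVec (b j) i) := by
    intro i j
    simp only [Matrix.mulVec, dotProduct]
    exact ContDiff.sum fun l _ => (hQ i l).mul contDiff_const
  let M : ℝ → Matrix (Fin N) (Fin N) ℂ := fun s => Matrix.of fun i j =>
    if j ∈ S then dslope (fun s => (Q s).mulVec (b j) i) 0 s else (Q s).mulVec (b j) i
  have hker : ∀ j ∈ S, (Q 0).mulVec (b j) = 0 := by
    intro j hj
    have := hp (b j)
    rw [hpb, if_pos hj] at this
    simpa using this
  have hdetM : ∀ s : ℝ, (Q s).det = (s : ℂ) ^ k * ((M s).det * B.det⁻¹) := by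
    intro s
    have h1 : Q s * B = Matrix.of fun i j => (if j ∈ S then (s : ℂ) else 1) * M s i j := by
      ext i j
      rw [hcol]
      by_cases hj : j ∈ S
      · have := sub_smul_dslope (fun s => (Q s).mulVec (b j) i) 0 s
        simp only [hker j hj, sub_zero, Pi.zero_apply] at this
        simp only [Matrix.of_apply, M, if_pos hj]
        rw [← this, Complex.real_smul]
      · simp [M, hj]
    have h2 := congrArg Matrix.det h1
    rw [Matrix.det_mul, Matrix.det_mul_row, Finset.prod_ite_mem, Finset.univ_inter,
      Finset.prod_const, hS, ← hk] at h2
    rw [← mul_assoc, ← h2, mul_assoc, mul_inv_cancel₀ hB, mul_one]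
  have hcont : ContinuousAt (fun s => (M s).det * B.det⁻¹) 0 := by
    refine ContinuousAt.mul ?_ continuousAt_const
    simp only [Matrix.det_apply']
    refine tendsto_finsetSum _ fun σ _ => Filter.Tendsto.mul tendsto_const_nhds ?_
    refine tendsto_finsetProd _ fun i _ => ?_
    by_cases hj : i ∈ S
    · simp only [M, Matrix.of_apply, if_pos hj]
      exact continuousAt_dslope_same.mpr ((hsm _ _).differentiable (by simp)).differentiableAt
    · simp only [M, Matrix.of_apply, if_neg hj]
      exact (hsm _ _).continuous.continuousAt
  have hsmooth : ContDiff ℝ (⊤ : ℕ∞) (fun s => (Q s).det) := by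
    simp only [Matrix.det_apply']
    exact ContDiff.sum fun σ _ => contDiff_const.mul (contDiff_prod fun i _ => hQ _ _)
  obtain ⟨hlow, htop⟩ := derivs_of_factor _ _ hsmooth k hcont hdetM
  refine ⟨?_, hlow⟩
  rw [htop]
  have hM0 : M 0 = LinearMap.toMatrix' F * B := by
    ext i j
    rw [hcol, LinearMap.toMatrix'_mulVec]
    by_cases hj : j ∈ S
    · simp only [M, Matrix.of_apply, if_pos hj, dslope_same, hF, LinearMap.add_apply,
        LinearMap.comp_apply, hpb, LinearMap.sub_apply, LinearMap.id_apply, sub_self, map_zero,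
        add_zero, Matrix.mulVecLin_apply]
      simp only [Matrix.mulVec, dotProduct, hD, Matrix.of_apply]
      rw [deriv_fun_sum]
      · refine Finset.sum_congr rfl fun l _ => ?_
        rw [deriv_mul_const ((hQ i l).differentiable (by simp)).differentiableAt]
      · intro l _
        exact (((hQ i l).differentiable (by simp)).differentiableAt).mul_const _
    · simp [M, hj, hF, hpb]
  have hfac : (k.factorial : ℂ) ≠ 0 := by exact_mod_cast k.factorial_ne_zero
  rw [hM0, Matrix.det_mul, mul_assoc, mul_inv_cancel₀ hB, mul_one, LinearMap.det_toMatrix']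
  rw [mul_ne_zero_iff, and_iff_right hfac, ← isUnit_iff_ne_zero,
    ← LinearMap.isUnit_iff_isUnit_det, LinearMap.isUnit_iff_ker_eq_bot, LinearMap.ker_eq_bot]

lemma key' {N : ℕ} (Q : ℝ → Matrix (Fin N) (Fin N) ℂ)
    (hQ : ∀ i j, ContDiff ℝ (⊤ : ℕ∞) fun s => Q s i j) (k : ℕ)
    (T : Matrix (Fin N) (Fin N) ℂ) (hT : Q 0 = T)
    (hk : k = Module.finrank ℂ (LinearMap.ker T.mulVecLin)) :
    (Function.Bijective (fun u : LinearMap.ker T.mulVecLin =>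
      (Submodule.Quotient.mk
        ((Matrix.of fun i j => deriv (fun s : ℝ => Q s i j) 0).mulVec u.1) :
        (Fin N → ℂ) ⧸ LinearMap.range T.mulVecLin)) ↔
      iteratedDeriv k (fun s => (Q s).det) 0 ≠ 0) ∧
    ∀ j < k, iteratedDeriv j (fun s => (Q s).det) 0 = 0 := by
  subst hT
  exact key Q hQ k hk

theorem principal_type_iff_det_derivative
    {d N : ℕ} (P : (Fin d → ℝ) → Matrix (Fin N) (Fin N) ℂ) (w₀ : Fin d → ℝ)
    (k : ℕ)
    (hP : ∀ i j, ContDiff ℝ (⊤ : ℕ∞) fun w => P w i j)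
    (hdet : (P w₀).det = 0)
    (hk : k = Module.finrank ℂ (LinearMap.ker (P w₀).mulVecLin)) :
    (IsPrincipalTypeAt P w₀ ↔
      ∃ ν : Fin d → ℝ,
        iteratedDeriv k (fun s : ℝ => (P (w₀ + s • ν)).det) 0 ≠ 0) ∧
    (∀ ν : Fin d → ℝ, ∀ j < k,
      iteratedDeriv j (fun s : ℝ => (P (w₀ + s • ν)).det) 0 = 0) := by
  have hν := fun ν : Fin d → ℝ => key' (fun s : ℝ => P (w₀ + s • ν))
      (fun i j => (hP i j).comp (contDiff_const.add (contDiff_id.smul contDiff_const))) k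
      (P w₀) (by simp) hk
  exact ⟨exists_congr fun ν => (hν ν).1, fun ν => (hν ν).2⟩
end
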